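/- The hat lattice homology is finite-dimensional: the 𝔽-chain complex Ĉ spanned by the pairs [K,E] with K ∈ Char(𝔰), E ⊆ V, graded by |E|, with differential ∂̂[K,E] = Σ_{v∈E, a_v(K,E)=0} [K, E∖{v}] + Σ_{v∈E, b_v(K,E)=0} [K + 2v*, E∖{v}], satisfies ∂̂ ∘ ∂̂ = 0 and its homology ĤF(G,𝔰) is a finite-dimensional 𝔽-vector space. -/

import Mathlib

open Finset

variable {V : Type*}

/-- `M` is negative definite: `xᵀMx < 0` for every nonzero `x ∈ ℝ^V`. -/
def NegDef [Fintype V] (M : V → V → ℤ) : Prop :=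
  ∀ x : V → ℝ, x ≠ 0 → (∑ v, ∑ w, (M v w : ℝ) * x v * x w) < 0

/-- `K` is a characteristic vector for `M`: `K(v) ≡ v·v (mod 2)` for all `v`. -/
def IsChar (M : V → V → ℤ) (K : V → ℤ) : Prop :=
  ∀ v, Int.ModEq 2 (K v) (M v v)

/-- `f(K, I) = (1/2)(Σ_{v∈I} K(v) + (Σ_{v∈I} v)·(Σ_{v∈I} v))` (an exact integer division
for characteristic `K`). -/
def latF (M : V → V → ℤ) (K : V → ℤ) (I : Finset V) : ℤ :=
  ((∑ v ∈ I, K v) + ∑ v ∈ I, ∑ w ∈ I, M v w) / 2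

/-- `g(K, E) = min_{I ⊆ E} f(K, I)`. -/
def latG (M : V → V → ℤ) (K : V → ℤ) (E : Finset V) : ℤ :=
  (E.powerset.image (latF M K)).min'
    ⟨_, Finset.mem_image_of_mem _ (Finset.empty_mem_powerset E)⟩

/-- `B_v(K, E) = min { f(K, I) : v ∈ I ⊆ E }` (for `v ∈ E`). -/
def latB [DecidableEq V] (M : V → V → ℤ) (K : V → ℤ) (E : Finset V) (v : V) : ℤ :=
  ((E.erase v).powerset.image (fun I => latF M K (insert v I))).min'
    ⟨_, Finset.mem_image_of_mem _ (Finset.empty_mem_powerset _)⟩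

/-- `a_v(K,E) = A_v(K,E) - g(K,E) = g(K, E∖{v}) - g(K,E)`. -/
def lata [DecidableEq V] (M : V → V → ℤ) (K : V → ℤ) (E : Finset V) (v : V) : ℤ :=
  latG M K (E.erase v) - latG M K E

/-- `b_v(K,E) = B_v(K,E) - g(K,E)`. -/
def latb [DecidableEq V] (M : V → V → ℤ) (K : V → ℤ) (E : Finset V) (v : V) : ℤ :=
  latB M K E v - latG M K E

/-- Membership in the spin^c equivalence class `Char(𝔰)` determined by `K₀`:
`K = K₀ + Σ_v 2 n_v v*`. -/
def CharCl [Fintype V] (M : V → V → ℤ) (K₀ : V → ℤ) (K : V → ℤ) : Prop :=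
  ∃ n : V → ℤ, ∀ w, K w = K₀ w + 2 * ∑ v, n v * M v w

lemma charCl_addDual [Fintype V] [DecidableEq V] (M : V → V → ℤ) (K₀ K : V → ℤ)
    (h : CharCl M K₀ K) (v : V) : CharCl M K₀ (fun w => K w + 2 * M v w) := by
  obtain ⟨n, hn⟩ := h
  refine ⟨fun u => n u + if u = v then 1 else 0, fun w => ?_⟩
  have hs : ∑ u, (n u + if u = v then 1 else 0) * M u w
      = (∑ u, n u * M u w) + M v w := by
    simp [add_mul, Finset.sum_add_distrib, ite_mul]
  show K w + 2 * M v w = K₀ w + 2 * ∑ u, (n u + if u = v then 1 else 0) * M u w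
  rw [hn w, hs]
  ring

/-- The hat lattice chain group: the `𝔽`-vector space spanned by the pairs `[K,E]` with
`K ∈ Char(𝔰)`, `E ⊆ V` (graded by `|E|`). -/
abbrev Chat [Fintype V] (M : V → V → ℤ) (K₀ : V → ℤ) : Type _ :=
  ({K : V → ℤ // CharCl M K₀ K} × Finset V) →₀ ZMod 2

/-- The hat differential
`∂̂[K,E] = Σ_{v∈E, a_v(K,E)=0} [K,E∖{v}] + Σ_{v∈E, b_v(K,E)=0} [K+2v*,E∖{v}]`. -/
noncomputable def dhat [Fintype V] [DecidableEq V] (M : V → V → ℤ) (K₀ : V → ℤ) :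
    Chat M K₀ →ₗ[ZMod 2] Chat M K₀ :=
  Finsupp.lift (Chat M K₀) (ZMod 2) ({K : V → ℤ // CharCl M K₀ K} × Finset V) fun g =>
    ∑ v ∈ g.2,
      ((if lata M g.1.1 g.2 v = 0 then Finsupp.single (g.1, g.2.erase v) (1 : ZMod 2) else 0)
       + (if latb M g.1.1 g.2 v = 0 then
            Finsupp.single
              (⟨fun w => g.1.1 w + 2 * M v w, charCl_addDual M K₀ g.1.1 g.1.2 v⟩,
               g.2.erase v) (1 : ZMod 2)
          else 0))


set_option linter.unusedSectionVars false

namespace LatHat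

/-- cells of the cubical model -/
abbrev Cell (V : Type*) : Type _ := (V → ℤ) × Finset V

abbrev Ch (V : Type*) : Type _ := Cell V →₀ ZMod 2

section
variable [DecidableEq V]

def sg (v : V) : V → ℤ := fun w => if w = v then 1 else 0

def ind (I : Finset V) : V → ℤ := fun w => if w ∈ I then 1 else 0

lemma ind_empty : ind (∅ : Finset V) = 0 := by ext; simp [ind]

lemma ind_insert {v : V} {I : Finset V} (h : v ∉ I) : ind (insert v I) = sg v + ind I := by
  ext w
  by_cases hw : w = v
  · subst hw; simp [ind, sg, h]
  · simp [ind, sg, hw]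

/-- weight of a cube -/
def W (q : (V → ℤ) → ℤ) (x : V → ℤ) (E : Finset V) : ℤ :=
  E.powerset.inf' ⟨∅, Finset.empty_mem_powerset E⟩ (fun I => q (x + ind I))

lemma W_empty (q : (V → ℤ) → ℤ) (x : V → ℤ) : W q x ∅ = q x := by
  simp [W, ind_empty]

lemma W_insert (q : (V → ℤ) → ℤ) (x : V → ℤ) {v : V} {E : Finset V} (h : v ∉ E) :
    W q x (insert v E) = min (W q x E) (W q (x + sg v) E) := by
  apply le_antisymm
  · apply le_min
    · apply Finset.le_inf'
      intro I hI
      apply Finset.inf'_le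
      rw [Finset.mem_powerset] at *
      exact hI.trans (Finset.subset_insert _ _)
    · apply Finset.le_inf'
      intro I hI
      rw [Finset.mem_powerset] at hI
      rw [add_assoc, ← ind_insert (fun hv => h (hI hv))]
      apply Finset.inf'_le (fun I => q (x + ind I))
      rw [Finset.mem_powerset]
      exact Finset.insert_subset_insert _ hI
  · apply Finset.le_inf'
    intro I hI
    rw [Finset.mem_powerset] at hI
    by_cases hv : v ∈ I
    · apply (min_le_right _ _).trans
      have h1 : v ∉ I.erase v := Finset.notMem_erase _ _
      have h2 : ind I = sg v + ind (I.erase v) := by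
        rw [← ind_insert h1, Finset.insert_erase hv]
      rw [h2, ← add_assoc]
      apply Finset.inf'_le (fun I => q (x + sg v + ind I))
      rw [Finset.mem_powerset]
      exact Finset.erase_subset_iff_of_mem (Finset.mem_insert_self _ _) |>.2 hI |> fun h' => by
        intro w hw
        have := hI (Finset.mem_of_mem_erase hw)
        rcases Finset.mem_insert.1 this with h3 | h3
        · exact absurd h3 (Finset.ne_of_mem_erase hw)
        · exact h3
    · apply (min_le_left _ _).trans
      apply Finset.inf'_le (fun I => q (x + ind I))
      rw [Finset.mem_powerset]
      exact (Finset.subset_insert_iff_of_notMem hv).1 hI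

/-- faces -/
def fc (v : V) (e : Bool) (c : Cell V) : Cell V :=
  ((if e then c.1 + sg v else c.1), c.2.erase v)

lemma fc_comm (v u : V) (e d : Bool) (c : Cell V) :
    fc u d (fc v e c) = fc v e (fc u d c) := by
  ext1
  · cases e <;> cases d <;> simp [fc, add_right_comm]
  · simp [fc, Finset.erase_right_comm]

def Wc (q : (V → ℤ) → ℤ) (c : Cell V) : ℤ := W q c.1 c.2

lemma Wc_eq_min (q : (V → ℤ) → ℤ) (c : Cell V) {v : V} (hv : v ∈ c.2) :
    Wc q c = min (Wc q (fc v false c)) (Wc q (fc v true c)) := by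
  have := W_insert q c.1 (Finset.notMem_erase v c.2)
  rw [Finset.insert_erase hv] at this
  simpa [Wc, fc] using this

lemma Wc_le (q : (V → ℤ) → ℤ) (c : Cell V) {v : V} (hv : v ∈ c.2) (e : Bool) :
    Wc q c ≤ Wc q (fc v e c) := by
  rw [Wc_eq_min q c hv]
  cases e
  · exact min_le_left _ _
  · exact min_le_right _ _

noncomputable def term (q : (V → ℤ) → ℤ) (c : Cell V) (v : V) (e : Bool) : Ch V :=
  if Wc q (fc v e c) = Wc q c then Finsupp.single (fc v e c) 1 else 0

noncomputable def D (q : (V → ℤ) → ℤ) : Ch V →ₗ[ZMod 2] Ch V :=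
  Finsupp.lift (Ch V) (ZMod 2) (Cell V) fun c => ∑ v ∈ c.2, ∑ e : Bool, term q c v e

lemma D_single (q : (V → ℤ) → ℤ) (c : Cell V) :
    D q (Finsupp.single c 1) = ∑ v ∈ c.2, ∑ e : Bool, term q c v e := by
  simp only [D, Finsupp.lift_apply]
  rw [Finsupp.sum_single_index] <;> simp

lemma add_self0 (z : Ch V) : z + z = 0 := ZModModule.add_self z

/-- symmetric off-diagonal sums vanish in characteristic two -/
lemma sum_symm_zero {A : Type*} [AddCommGroup A] (h2 : ∀ a : A, a + a = 0)
    (T : V → V → A) (E : Finset V) (hT : ∀ v ∈ E, ∀ u ∈ E, T v u = T u v) :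
    ∑ v ∈ E, ∑ u ∈ E.erase v, T v u = 0 := by
  induction E using Finset.induction_on with
  | empty => simp
  | insert a E ha ih =>
    rw [Finset.sum_insert ha, Finset.erase_insert ha]
    have : ∀ v ∈ E, ∑ u ∈ (insert a E).erase v, T v u = T v a + ∑ u ∈ E.erase v, T v u := by
      intro v hv
      have hne : a ≠ v := fun h => ha (h ▸ hv)
      rw [Finset.erase_insert_of_ne hne, Finset.sum_insert (fun h => ha (Finset.mem_of_mem_erase h))]
    rw [Finset.sum_congr rfl this, Finset.sum_add_distrib,
      ih (fun v hv u hu => hT v (Finset.mem_insert_of_mem hv) u (Finset.mem_insert_of_mem hu)),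
      add_zero]
    have h3 : ∑ v ∈ E, T v a = ∑ v ∈ E, T a v :=
      Finset.sum_congr rfl fun v hv => hT v (Finset.mem_insert_of_mem hv) a (Finset.mem_insert_self _ _)
    rw [h3, h2]

lemma D_term (q : (V → ℤ) → ℤ) (c : Cell V) {v : V} (hv : v ∈ c.2) (e : Bool) :
    D q (term q c v e) = ∑ u ∈ c.2.erase v, ∑ d : Bool,
      if Wc q (fc u d (fc v e c)) = Wc q c then Finsupp.single (fc u d (fc v e c)) 1 else 0 := by
  unfold term
  split_ifs with h
  · rw [D_single]
    apply Finset.sum_congr rfl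
    intro u hu
    apply Finset.sum_congr rfl
    intro d _
    unfold term
    rw [h]
  · rw [map_zero]
    symm
    apply Finset.sum_eq_zero
    intro u hu
    apply Finset.sum_eq_zero
    intro d _
    rw [if_neg]
    intro h'
    apply h
    apply le_antisymm _ (Wc_le q c hv e)
    rw [← h']
    exact Wc_le q _ hu d

lemma D_D (q : (V → ℤ) → ℤ) : (D q).comp (D q) = 0 := by
  apply Finsupp.lhom_ext'
  intro c
  ext1
  simp only [LinearMap.comp_apply, Finsupp.lsingle_apply, LinearMap.zero_apply]
  rw [D_single, map_sum]
  have : ∀ v ∈ c.2, D q (∑ e : Bool, term q c v e) = ∑ u ∈ c.2.erase v,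
      ∑ e : Bool, ∑ d : Bool,
      if Wc q (fc u d (fc v e c)) = Wc q c then
        (Finsupp.single (fc u d (fc v e c)) 1 : Ch V) else 0 := by
    intro v hv
    rw [map_sum, Finset.sum_comm]
    exact Finset.sum_congr rfl fun e _ => D_term q c hv e
  rw [Finset.sum_congr rfl this]
  apply sum_symm_zero add_self0
  intro v _ u _
  rw [Finset.sum_comm]
  apply Finset.sum_congr rfl
  intro d _
  apply Finset.sum_congr rfl
  intro e _
  rw [fc_comm]

/-- every cycle in `B` is homologous to a chain in `S` -/
def Red (q : (V → ℤ) → ℤ) (B S : Set (Cell V)) : Prop :=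
  ∀ z ∈ Finsupp.supported (ZMod 2) (ZMod 2) B, D q z = 0 →
    ∃ u, z + D q u ∈ Finsupp.supported (ZMod 2) (ZMod 2) S

lemma Red.trans {q : (V → ℤ) → ℤ} {B S T : Set (Cell V)} (h1 : Red q B S) (h2 : Red q S T) :
    Red q B T := by
  intro z hz hd
  obtain ⟨u, hu⟩ := h1 z hz hd
  obtain ⟨u', hu'⟩ := h2 _ hu (by
    rw [map_add, hd, zero_add]
    exact LinearMap.congr_fun (D_D q) u)
  exact ⟨u + u', by rw [map_add, ← add_assoc]; exact hu'⟩

lemma Red.mono {q : (V → ℤ) → ℤ} {B B' S S' : Set (Cell V)} (h1 : Red q B S)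
    (hB : B' ⊆ B) (hS : S ⊆ S') : Red q B' S' := by
  intro z hz hd
  obtain ⟨u, hu⟩ := h1 z (Finsupp.supported_mono hB hz) hd
  exact ⟨u, Finsupp.supported_mono hS hu⟩

lemma single_mem {S : Set (Cell V)} {c : Cell V} (h : c ∈ S) :
    (Finsupp.single c 1 : Ch V) ∈ Finsupp.supported (ZMod 2) (ZMod 2) S :=
  Finsupp.single_mem_supported _ _ h

/-- homotopy criterion -/
lemma red_of_homotopy (q : (V → ℤ) → ℤ) (B S : Set (Cell V)) (H : Ch V →ₗ[ZMod 2] Ch V)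
    (h : ∀ c ∈ B, Finsupp.single c 1 + D q (H (Finsupp.single c 1)) + H (D q (Finsupp.single c 1))
      ∈ Finsupp.supported (ZMod 2) (ZMod 2) S) : Red q B S := by
  intro z hz hd
  refine ⟨H z, ?_⟩
  let L : Ch V →ₗ[ZMod 2] Ch V := LinearMap.id + (D q).comp H + H.comp (D q)
  have hL : L z = z + D q (H z) := by simp [L, hd]
  rw [← hL]
  have : Finsupp.supported (ZMod 2) (ZMod 2) B ≤
      (Finsupp.supported (ZMod 2) (ZMod 2) S).comap L := by
    rw [Finsupp.supported_eq_span_single, Submodule.span_le]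
    rintro _ ⟨c, hc, rfl⟩
    exact h c hc
  exact this hz

lemma W_lt (q : (V → ℤ) → ℤ) (P : V → (V → ℤ) → Prop)
    (ha : ∀ v u x, u ≠ v → P v x → P v (x + sg u))
    (hb : ∀ v x, P v x → q x < q (x + sg v)) (v : V) (E : Finset V) (hE : v ∉ E) :
    ∀ x, P v x → W q x E < W q (x + sg v) E := by
  induction E using Finset.induction_on with
  | empty => intro x hx; simpa [W_empty] using hb v x hx
  | insert a E haE ih =>
    intro x hx
    have hva : a ≠ v := fun h => hE (h ▸ Finset.mem_insert_self _ _)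
    have hvE : v ∉ E := fun h => hE (Finset.mem_insert_of_mem h)
    rw [W_insert q x haE, W_insert q (x + sg v) haE]
    have h1 := ih hvE x hx
    have h2 := ih hvE (x + sg a) (ha v a x hva hx)
    rw [add_right_comm] at h2
    exact min_lt_min h1 h2

lemma W_ins (q : (V → ℤ) → ℤ) (P : V → (V → ℤ) → Prop)
    (ha : ∀ v u x, u ≠ v → P v x → P v (x + sg u))
    (hb : ∀ v x, P v x → q x < q (x + sg v)) (v : V) (E : Finset V) (hE : v ∉ E)
    (x : V → ℤ) (hx : P v x) : W q x (insert v E) = W q x E := by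
  rw [W_insert q x hE]
  exact min_eq_left (W_lt q P ha hb v E hE x hx).le

open Classical in
noncomputable def Hm (A : (V → ℤ) → Prop) (v : V) : Ch V →ₗ[ZMod 2] Ch V :=
  Finsupp.lift (Ch V) (ZMod 2) (Cell V) fun c =>
    if A c.1 ∧ v ∉ c.2 then Finsupp.single (c.1, insert v c.2) 1 else 0

open Classical in
lemma Hm_single (A : (V → ℤ) → Prop) (v : V) (c : Cell V) :
    Hm A v (Finsupp.single c 1) =
      if A c.1 ∧ v ∉ c.2 then Finsupp.single (c.1, insert v c.2) 1 else 0 := by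
  simp only [Hm, Finsupp.lift_apply]
  rw [Finsupp.sum_single_index] <;> simp

/-- the region attached to a set of vertices -/
def FS (P : V → (V → ℤ) → Prop) (S : Finset V) : Set (Cell V) :=
  {c | (∃ v ∈ S, P v c.1) ∨ ∀ v, ¬ P v c.1}

lemma phase_step (q : (V → ℤ) → ℤ) (P : V → (V → ℤ) → Prop)
    (ha : ∀ v u x, u ≠ v → P v x → P v (x + sg u))
    (hb : ∀ v x, P v x → q x < q (x + sg v))
    (hn : ∀ x, (∀ v, ¬ P v x) → ∀ u v, ¬ P v (x + sg u))
    (B : Set (Cell V)) (hB : ∀ c ∈ B, ∀ v ∈ c.2, ∀ e, fc v e c ∈ B)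
    (hB' : ∀ c ∈ B, ∀ v, P v c.1 → (c.1, insert v c.2) ∈ B)
    (S : Finset V) (v : V) : Red q (B ∩ FS P (insert v S)) (B ∩ FS P S) := by
  classical
  let A : (V → ℤ) → Prop := fun x => P v x ∧ ∀ u ∈ S, ¬ P u x
  -- a nontrivial face term stays in the region of a positive vertex
  have key : ∀ c : Cell V, ∀ w, P w c.1 → ∀ u ∈ c.2, ∀ e,
      Wc q (fc u e c) = Wc q c → P w (fc u e c).1 := by
    intro c w hw u hu e he
    cases e
    · simpa [fc] using hw
    · by_cases huw : u = w
      · subst huw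
        exfalso
        have h1 := W_lt q P ha hb u (c.2.erase u) (Finset.notMem_erase _ _) c.1 hw
        have h2 := Wc_le q c hu false
        rw [← he] at h2
        simp only [Wc, fc] at h2
        simp at h2
        omega
      · simpa [fc] using ha w u c.1 huw hw
  have keyS : ∀ c ∈ FS P S, ∀ u ∈ c.2, ∀ e, Wc q (fc u e c) = Wc q c → fc u e c ∈ FS P S := by
    rintro c (⟨w, hw, hP⟩ | h) u hu e he
    · exact Or.inl ⟨w, hw, key c w hP u hu e he⟩
    · right
      intro w
      cases e
      · simpa [fc] using h w
      · simpa [fc] using hn c.1 h u w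
  have hAS : ∀ c : Cell V, c ∈ FS P S → ¬ A c.1 := by
    rintro c (⟨w, hw, hP⟩ | h) ⟨h1, h2⟩
    · exact h2 w hw hP
    · exact h v h1
  have hAS' : ∀ c : Cell V, P v c.1 → ¬ A c.1 → c ∈ FS P S := by
    intro c hc hA
    by_contra hcon
    apply hA
    refine ⟨hc, fun u hu hP => hcon (Or.inl ⟨u, hu, hP⟩)⟩
  apply red_of_homotopy q _ _ (Hm A v)
  rintro ⟨x, E⟩ ⟨hcB, hcF⟩
  by_cases hA : A x
  · by_cases hv : v ∈ E
    · -- the cell is hit by the homotopy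
      have h1 : Hm A v (Finsupp.single (x, E) 1) = 0 := by
        rw [Hm_single, if_neg]; simp [hv]
      have h2 : Hm A v (D q (Finsupp.single (x, E) 1)) = Finsupp.single (x, E) 1 := by
        rw [D_single, map_sum]
        rw [Finset.sum_eq_single_of_mem v hv]
        · rw [Fintype.sum_bool, map_add]
          have hlt := W_lt q P ha hb v (E.erase v) (Finset.notMem_erase _ _) x hA.1
          have hmin := Wc_eq_min q (x, E) hv
          have e1 : Wc q (fc v true (x, E)) = W q (x + sg v) (E.erase v) := by simp [Wc, fc]
          have e2 : Wc q (fc v false (x, E)) = W q x (E.erase v) := by simp [Wc, fc]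
          have t1 : term q (x, E) v true = 0 := by
            rw [term, if_neg]
            rw [hmin, e1, e2]; omega
          have t2 : term q (x, E) v false = Finsupp.single (x, E.erase v) 1 := by
            rw [term, if_pos]
            · simp [fc]
            · rw [hmin, e1, e2]; omega
          rw [t1, t2, map_zero, zero_add, Hm_single, if_pos]
          · simp [Finset.insert_erase hv]
          · simp [hA]
        · intro u hu huv
          rw [map_sum]
          apply Finset.sum_eq_zero
          intro e _
          rw [term]
          split_ifs
          · rw [Hm_single, if_neg]
            simp [fc, hv, huv.symm]
          · simp
      rw [h1, h2, map_zero, add_zero, add_self0]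
      exact Submodule.zero_mem _
    · have h1 : Hm A v (Finsupp.single (x, E) 1) = Finsupp.single (x, insert v E) 1 := by
        rw [Hm_single, if_pos]; simp [hv, hA]
      rw [h1, D_single, D_single]
      simp only
      rw [Finset.sum_insert hv]
      have hWi : Wc q (x, insert v E) = Wc q (x, E) := W_ins q P ha hb v E hv x hA.1
      have t0 : ∑ e : Bool, term q (x, insert v E) v e = Finsupp.single (x, E) 1 := by
        rw [Fintype.sum_bool]
        have hlt := W_lt q P ha hb v E hv x hA.1
        have t1 : term q (x, insert v E) v true = 0 := by
          rw [term, if_neg]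
          rw [hWi]
          simp only [Wc, fc, Finset.erase_insert hv]
          simp
          omega
        have t2 : term q (x, insert v E) v false = Finsupp.single (x, E) 1 := by
          rw [term, if_pos]
          · simp [fc, Finset.erase_insert hv]
          · rw [hWi]
            simp [Wc, fc, Finset.erase_insert hv]
        rw [t1, t2, zero_add]
      rw [t0, ← add_assoc, add_self0, zero_add, map_sum, ← Finset.sum_add_distrib]
      apply Submodule.sum_mem
      intro u hu
      rw [map_sum, ← Finset.sum_add_distrib]
      apply Submodule.sum_mem
      intro e _
      have huv : u ≠ v := fun h => hv (h ▸ hu)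
      have hPf : P v (fc u e (x, E)).1 := by
        cases e
        · simpa [fc] using hA.1
        · simpa [fc] using ha v u x huv hA.1
      have hf : fc u e (x, insert v E) = ((fc u e (x, E)).1, insert v (fc u e (x, E)).2) := by
        simp [fc, Finset.erase_insert_of_ne huv.symm]
      have hvf : v ∉ (fc u e (x, E)).2 := by simp [fc, hv]
      have hWf : Wc q (fc u e (x, insert v E)) = Wc q (fc u e (x, E)) := by
        rw [hf]
        exact W_ins q P ha hb v _ hvf _ hPf
      unfold term
      rw [hWf, hWi]
      split_ifs with hcond
      · rw [Hm_single, hf]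
        by_cases hAf : A (fc u e (x, E)).1
        · rw [if_pos ⟨hAf, hvf⟩, add_self0]
          exact Submodule.zero_mem _
        · rw [if_neg (fun h => hAf h.1), add_zero]
          apply single_mem
          refine ⟨?_, hAS' _ hPf hAf⟩
          exact hB' _ (hB _ hcB u hu e) v hPf
      · simp
  · have hS : ((x, E) : Cell V) ∈ FS P S := by
      rcases hcF with ⟨w, hw, hP⟩ | h
      · rcases Finset.mem_insert.1 hw with rfl | hw
        · exact hAS' _ hP hA
        · exact Or.inl ⟨w, hw, hP⟩
      · exact Or.inr h
    have h1 : Hm A v (Finsupp.single (x, E) 1) = 0 := by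
      rw [Hm_single, if_neg]; exact fun h => hA h.1
    have h2 : Hm A v (D q (Finsupp.single (x, E) 1)) = 0 := by
      rw [D_single, map_sum]
      apply Finset.sum_eq_zero
      intro u hu
      rw [map_sum]
      apply Finset.sum_eq_zero
      intro e _
      rw [term]
      split_ifs with hc
      · rw [Hm_single, if_neg]
        exact fun h => hAS _ (keyS _ hS u hu e hc) h.1
      · simp
    rw [h1, h2, map_zero, add_zero, add_zero]
    exact single_mem ⟨hcB, hS⟩

lemma phase [Fintype V] (q : (V → ℤ) → ℤ) (P : V → (V → ℤ) → Prop)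
    (ha : ∀ v u x, u ≠ v → P v x → P v (x + sg u))
    (hb : ∀ v x, P v x → q x < q (x + sg v))
    (hn : ∀ x, (∀ v, ¬ P v x) → ∀ u v, ¬ P v (x + sg u))
    (B : Set (Cell V)) (hB : ∀ c ∈ B, ∀ v ∈ c.2, ∀ e, fc v e c ∈ B)
    (hB' : ∀ c ∈ B, ∀ v, P v c.1 → (c.1, insert v c.2) ∈ B) :
    Red q B (B ∩ {c | ∀ v, ¬ P v c.1}) := by
  have main : ∀ S : Finset V, Red q (B ∩ FS P S) (B ∩ FS P ∅) := by
    intro S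
    induction S using Finset.induction_on with
    | empty => intro z hz _; exact ⟨0, by simpa using hz⟩
    | insert v S _ ih => exact (phase_step q P ha hb hn B hB hB' S v).trans ih
  refine (main Finset.univ).mono ?_ ?_
  · intro c hc
    refine ⟨hc, ?_⟩
    by_cases h : ∃ v, P v c.1
    · obtain ⟨v, hv⟩ := h
      exact Or.inl ⟨v, Finset.mem_univ _, hv⟩
    · exact Or.inr (by simpa using h)
  · rintro c ⟨hc, h | h⟩
    · simp at h
    · exact ⟨hc, h⟩

/-- the reflection -/
def sig (c : Cell V) : Cell V := (-c.1 - ind c.2, c.2)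

lemma sig_sig (c : Cell V) : sig (sig c) = c := by
  ext1
  · simp [sig]
  · rfl

lemma W_sig (q : (V → ℤ) → ℤ) (E : Finset V) :
    ∀ x, W (fun y => q (-y)) (-x - ind E) E = W q x E := by
  induction E using Finset.induction_on with
  | empty => intro x; simp [W_empty, ind_empty]
  | insert a E ha ih =>
    intro x
    rw [W_insert _ _ ha, W_insert _ _ ha, ind_insert ha, min_comm]
    have h1 : -x - (sg a + ind E) = -(x + sg a) - ind E := by abel
    have h2 : -x - (sg a + ind E) + sg a = -x - ind E := by abel
    rw [h2, h1, ih, ih]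

lemma Wc_sig (q : (V → ℤ) → ℤ) (c : Cell V) : Wc (fun y => q (-y)) (sig c) = Wc q c :=
  W_sig q c.2 c.1

lemma fc_sig (c : Cell V) {v : V} (hv : v ∈ c.2) (e : Bool) :
    fc v e (sig c) = sig (fc v (!e) c) := by
  have h : ind c.2 = sg v + ind (c.2.erase v) := by
    rw [← ind_insert (Finset.notMem_erase _ _), Finset.insert_erase hv]
  ext1
  · cases e
    · simp only [fc, sig, h]; simp; abel
    · simp only [fc, sig, h]; simp; abel
  · rfl

noncomputable def sm : Ch V →ₗ[ZMod 2] Ch V := Finsupp.lmapDomain (ZMod 2) (ZMod 2) sig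

lemma sm_single (c : Cell V) : sm (Finsupp.single c 1) = Finsupp.single (sig c) 1 := by
  simp [sm]

lemma sm_D (q : (V → ℤ) → ℤ) (z : Ch V) : sm (D q z) = D (fun y => q (-y)) (sm z) := by
  have : sm.comp (D q) = (D (fun y => q (-y))).comp sm := by
    apply Finsupp.lhom_ext'
    intro c
    ext1
    simp only [LinearMap.comp_apply, Finsupp.lsingle_apply]
    rw [sm_single, D_single, D_single, map_sum]
    apply Finset.sum_congr rfl
    intro v hv
    have ht : ∀ e, sm (term q c v e) = term (fun y => q (-y)) (sig c) v (!e) := by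
      intro e
      unfold term
      rw [fc_sig c hv, Wc_sig, Wc_sig, Bool.not_not]
      split_ifs
      · rw [sm_single]
      · simp
    simp only [Fintype.sum_bool, map_add, ht, Bool.not_true, Bool.not_false]
    rw [add_comm]
  exact LinearMap.congr_fun this z

lemma sm_mem {S : Set (Cell V)} {z : Ch V} (hz : z ∈ Finsupp.supported (ZMod 2) (ZMod 2) S) :
    sm z ∈ Finsupp.supported (ZMod 2) (ZMod 2) (sig ⁻¹' S) := by
  have : Finsupp.supported (ZMod 2) (ZMod 2) S ≤
      (Finsupp.supported (ZMod 2) (ZMod 2) (sig ⁻¹' S)).comap sm := by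
    rw [Finsupp.supported_eq_span_single, Submodule.span_le]
    rintro _ ⟨c, hc, rfl⟩
    rw [SetLike.mem_coe, Submodule.mem_comap]
    rw [sm_single]
    apply single_mem
    simpa [sig_sig] using hc
  exact this hz

lemma sm_sm (z : Ch V) : sm (sm z) = z := by
  have : (sm (V := V)).comp (sm (V := V)) = LinearMap.id := by
    apply Finsupp.lhom_ext'
    intro c
    ext1
    simp only [LinearMap.comp_apply, Finsupp.lsingle_apply, sm_single, sig_sig, LinearMap.id_apply]
  exact LinearMap.congr_fun this z

lemma Red.of_sig {q : (V → ℤ) → ℤ} {B S : Set (Cell V)}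
    (h : Red (fun y => q (-y)) (LatHat.sig ⁻¹' B) (LatHat.sig ⁻¹' S)) : Red q B S := by
  intro z hz hd
  obtain ⟨u, hu⟩ := h (sm z) (sm_mem hz) (by rw [← sm_D, hd, map_zero])
  refine ⟨sm u, ?_⟩
  have h1 := sm_mem hu
  rw [map_add, sm_sm, sm_D] at h1
  simpa only [neg_neg, ← Set.preimage_comp, Function.comp_def, sig_sig, Set.preimage_id'] using h1

end

section quad
variable [DecidableEq V] [Fintype V]

def mv (M : V → V → ℤ) (x : V → ℤ) (v : V) : ℤ := ∑ w, M v w * x w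

lemma mv_add (M : V → V → ℤ) (x y : V → ℤ) (v : V) : mv M (x + y) v = mv M x v + mv M y v := by
  simp [mv, mul_add, Finset.sum_add_distrib]

lemma mv_neg (M : V → V → ℤ) (x : V → ℤ) (v : V) : mv M (-x) v = - mv M x v := by
  simp [mv]

lemma mv_sg (M : V → V → ℤ) (u v : V) : mv M (sg u) v = M v u := by
  simp [mv, sg]

lemma negDef_int {M : V → V → ℤ} (h : NegDef M) (x : V → ℤ) (hx : x ≠ 0) :
    ∑ v, ∑ w, M v w * x v * x w < 0 := by
  have := h (fun v => (x v : ℝ)) (by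
    intro h0; apply hx; ext v
    have := congrFun h0 v
    simpa using this)
  exact_mod_cast this

lemma max_principle {M : V → V → ℤ} (h : NegDef M)
    (hoff : ∀ v w, v ≠ w → M v w = 0 ∨ M v w = 1) (z : V → ℤ)
    (hz : ∀ v, z v < 0 → mv M z v ≤ 0) (v : V) : 0 ≤ z v := by
  by_contra hv
  push Not at hv
  let n : V → ℤ := fun v => max (-z v) 0
  have hn0 : n ≠ 0 := by
    intro h0
    have := congrFun h0 v
    simp only [n, Pi.zero_apply] at this
    omega
  have h1 := negDef_int h n hn0
  have h2 : ∑ v, n v * mv M z v ≤ 0 := by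
    apply Finset.sum_nonpos
    intro v _
    by_cases hzv : z v < 0
    · exact mul_nonpos_of_nonneg_of_nonpos (le_max_right _ _) (hz v hzv)
    · have : n v = 0 := by simp only [n]; omega
      simp [this]
  have h3 : ∑ v, n v * mv M z v + ∑ v, ∑ w, M v w * n v * n w ≥ 0 := by
    rw [← Finset.sum_add_distrib]
    apply Finset.sum_nonneg
    intro v _
    rw [mv, Finset.mul_sum, ← Finset.sum_add_distrib]
    apply Finset.sum_nonneg
    intro w _
    have hnv : 0 ≤ n v := le_max_right _ _
    have e : n v * (M v w * z w) + M v w * n v * n w = M v w * (n v * (z w + n w)) := by ring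
    rw [e]
    by_cases hvw : v = w
    · subst hvw
      have : n v * (z v + n v) = 0 := by
        rw [mul_eq_zero]; simp only [n]; omega
      simp [this]
    · have hM : 0 ≤ M v w := by rcases hoff v w hvw with h | h <;> omega
      apply mul_nonneg hM
      apply mul_nonneg hnv
      simp only [n]; omega
  linarith

lemma det_ne {M : V → V → ℤ} (h : NegDef M) : (Matrix.of M).det ≠ 0 := by
  intro hd
  obtain ⟨x, hx, h0⟩ := Matrix.exists_mulVec_eq_zero_iff.2 hd
  have h1 := negDef_int h x hx
  have h2 : ∀ v, ∑ w, M v w * x v * x w = 0 := by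
    intro v
    have := congrFun h0 v
    simp only [Matrix.mulVec, dotProduct, Matrix.of_apply, Pi.zero_apply] at this
    have e : ∑ w, M v w * x v * x w = x v * ∑ w, M v w * x w := by
      rw [Finset.mul_sum]; exact Finset.sum_congr rfl fun w _ => by ring
    rw [e, this, mul_zero]
  simp [h2] at h1

lemma mv_inj {M : V → V → ℤ} (h : NegDef M) {x y : V → ℤ} (hxy : ∀ v, mv M x v = mv M y v) :
    x = y := by
  by_contra hne
  apply det_ne h
  refine Matrix.exists_mulVec_eq_zero_iff.1 ⟨x - y, sub_ne_zero.2 hne, ?_⟩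
  ext v
  have := hxy v
  simp only [mv] at this
  simp [Matrix.mulVec, dotProduct, mul_sub, Finset.sum_sub_distrib, this]

lemma exists_pos {M : V → V → ℤ} (h : NegDef M) : ∃ z : V → ℤ, ∀ v, 1 ≤ mv M z v := by
  refine ⟨(Matrix.of M).adjugate.mulVec (fun _ => (Matrix.of M).det), fun v => ?_⟩
  have h1 : (Matrix.of M).mulVec ((Matrix.of M).adjugate.mulVec (fun _ => (Matrix.of M).det)) v
      = (Matrix.of M).det * (Matrix.of M).det := by
    rw [Matrix.mulVec_mulVec, Matrix.mul_adjugate]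
    simp
  have h2 : mv M ((Matrix.of M).adjugate.mulVec (fun _ => (Matrix.of M).det)) v
      = (Matrix.of M).det * (Matrix.of M).det := by
    rw [← h1]; rfl
  rw [h2]
  have := mul_self_pos.2 (det_ne h)
  omega

lemma exists_large {M : V → V → ℤ} (h : NegDef M) (k : V → ℤ) :
    ∃ z : V → ℤ, ∀ v, |k v| + 1 ≤ mv M z v := by
  obtain ⟨z, hz⟩ := exists_pos h
  refine ⟨fun w => (∑ u, |k u| + 1) * z w, fun v => ?_⟩
  have e : mv M (fun w => (∑ u, |k u| + 1) * z w) v = (∑ u, |k u| + 1) * mv M z v := by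
    simp only [mv]; rw [Finset.mul_sum]; exact Finset.sum_congr rfl fun w _ => by ring
  rw [e]
  have h1 : |k v| ≤ ∑ u, |k u| :=
    Finset.single_le_sum (f := fun u => |k u|) (fun u _ => abs_nonneg _) (Finset.mem_univ v)
  have h2 : 0 ≤ |k v| := abs_nonneg _
  nlinarith [hz v]

lemma quad_phase {M : V → V → ℤ} (h : NegDef M)
    (hoff : ∀ v w, v ≠ w → M v w = 0 ∨ M v w = 1) (q : (V → ℤ) → ℤ) (k : V → ℤ)
    (hq : ∀ x v, q (x + sg v) = q x + k v + mv M x v) (m : V → ℤ)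
    (hm : ∀ v, 0 < k v + mv M m v)
    (B : Set (Cell V)) (hB : ∀ c ∈ B, ∀ v ∈ c.2, ∀ e, fc v e c ∈ B)
    (hB' : ∀ c ∈ B, ∀ v, c.1 v < m v → (c.1, insert v c.2) ∈ B) :
    Red q B (B ∩ {c | ∀ v, m v ≤ c.1 v}) := by
  have hno : ∀ x : V → ℤ, (∀ v, ¬ (x v < m v ∧ 0 < k v + mv M x v)) → ∀ v, m v ≤ x v := by
    intro x hx v
    have := max_principle h hoff (x - m) (by
      intro v hv
      have h1 := hx v
      have h2 := hm v
      have h3 : mv M (x - m) v = mv M x v - mv M m v := by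
        rw [sub_eq_add_neg, mv_add, mv_neg]; ring
      simp only [Pi.sub_apply] at hv
      rw [h3]
      by_contra hc
      apply h1
      constructor <;> omega) v
    simp only [Pi.sub_apply] at this
    omega
  refine (phase q (fun v x => x v < m v ∧ 0 < k v + mv M x v) ?_ ?_ ?_ B hB
    (fun c hc v hv => hB' c hc v hv.1)).mono le_rfl ?_
  · rintro v u x huv ⟨h1, h2⟩
    refine ⟨by simpa [sg, huv.symm] using h1, ?_⟩
    rw [mv_add, mv_sg]
    rcases hoff v u huv.symm with h3 | h3 <;> omega
  · rintro v x ⟨h1, h2⟩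
    rw [hq]; omega
  · rintro x hx u v ⟨h1, h2⟩
    have h3 := hno x hx v
    simp only [Pi.add_apply, sg] at h1
    split_ifs at h1 <;> omega
  · rintro c ⟨hc, hx⟩
    exact ⟨hc, hno c.1 hx⟩

lemma finite_red {M : V → V → ℤ} (h : NegDef M)
    (hoff : ∀ v w, v ≠ w → M v w = 0 ∨ M v w = 1) (q : (V → ℤ) → ℤ) (k : V → ℤ)
    (hq : ∀ x v, q (x + sg v) = q x + k v + mv M x v) :
    ∃ S : Set (Cell V), S.Finite ∧ Red q Set.univ S := by
  obtain ⟨m, hm⟩ := exists_large h (fun v => |k v| + |M v v|)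
  have hm' : ∀ v, |k v| + |M v v| + 1 ≤ mv M m v := fun v => (add_le_add_left (le_abs_self _) 1).trans (hm v)
  have hm0 : ∀ v, m v ≤ 0 := by
    intro v
    have := max_principle h hoff (-m) (by
      intro u _
      rw [mv_neg]
      have := hm' u
      have := abs_nonneg (k u)
      have := abs_nonneg (M u u)
      omega) v
    simp only [Pi.neg_apply] at this
    omega
  have p1 := quad_phase h hoff q k hq m (fun v => by
    have := hm' v
    have := neg_abs_le (k v)
    have := abs_nonneg (M v v)
    omega) Set.univ (fun _ _ _ _ _ => trivial) (fun _ _ _ _ => trivial)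
  rw [Set.univ_inter] at p1
  have p2 : Red q {c : Cell V | ∀ v, m v ≤ c.1 v}
      ({c | ∀ v, m v ≤ c.1 v} ∩ {c | ∀ v, m v ≤ (sig c).1 v}) := by
    apply Red.of_sig
    have hq' : ∀ x v, q (-(x + sg v)) = q (-x) + (M v v - k v) + mv M x v := by
      intro x v
      have := hq (-(x + sg v)) v
      rw [mv_neg, mv_add, mv_sg] at this
      have e : -(x + sg v) + sg v = -x := by abel
      rw [e] at this
      omega
    have := quad_phase h hoff (fun y => q (-y)) (fun v => M v v - k v) hq' m (fun v => by
      have := hm' v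
      have := le_abs_self (k v)
      have := neg_abs_le (M v v)
      omega) (sig ⁻¹' {c : Cell V | ∀ v, m v ≤ c.1 v}) (by
        intro c hc v hv e w
        have h1 := hc w
        simp only [sig, fc, Pi.sub_apply, Pi.neg_apply, ind, Finset.mem_erase] at h1 ⊢
        by_cases hwv : w = v
        · subst hwv
          rw [if_pos hv] at h1
          cases e <;> simp [sg] <;> omega
        · simp only [ne_eq, hwv, not_false_eq_true, true_and]
          cases e <;> simp [sg, hwv] <;> omega) (by
        intro c hc v hv w
        have h1 := hc w
        have h2 := hm0 v
        simp only [sig, Pi.sub_apply, Pi.neg_apply, ind, Finset.mem_insert] at h1 ⊢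
        by_cases hwv : w = v
        · subst hwv
          simp
          omega
        · simp only [hwv, false_or]
          exact h1)
    refine this.mono le_rfl ?_
    rintro c ⟨h1, h2⟩
    refine ⟨h1, ?_⟩
    intro v
    rw [sig_sig]
    exact h2 v
  refine ⟨_, ?_, p1.trans p2⟩
  apply Set.Finite.subset ((Set.finite_Icc m (-m)).prod (Set.toFinite (Set.univ : Set (Finset V))))
  rintro c ⟨h1, h2⟩
  refine ⟨⟨h1, fun v => ?_⟩, trivial⟩
  have h3 := h2 v
  simp only [sig, Pi.sub_apply, Pi.neg_apply, ind] at h3 ⊢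
  split_ifs at h3 <;> omega

end quad

section transport
variable [DecidableEq V] [Fintype V]

/-- numerator of the quadratic weight -/
def num (M : V → V → ℤ) (K₀ x : V → ℤ) : ℤ := ∑ v, K₀ v * x v + ∑ v, x v * mv M x v

def Q (M : V → V → ℤ) (K₀ : V → ℤ) (x : V → ℤ) : ℤ := num M K₀ x / 2

def KK (M : V → V → ℤ) (K₀ x : V → ℤ) : V → ℤ := fun w => K₀ w + 2 * ∑ v, x v * M v w

lemma sum_mv_symm {M : V → V → ℤ} (hsym : ∀ v w, M v w = M w v) (x y : V → ℤ) :
    ∑ v, x v * mv M y v = ∑ v, y v * mv M x v := by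
  simp only [mv, Finset.mul_sum]
  rw [Finset.sum_comm]
  refine Finset.sum_congr rfl fun v _ => Finset.sum_congr rfl fun w _ => ?_
  rw [hsym w v]; ring

lemma num_add {M : V → V → ℤ} (hsym : ∀ v w, M v w = M w v) (K₀ x y : V → ℤ) :
    num M K₀ (x + y) = num M K₀ x + num M K₀ y + 2 * ∑ v, y v * mv M x v := by
  have := sum_mv_symm hsym x y
  simp only [num, Pi.add_apply, mv_add, mul_add, add_mul, Finset.sum_add_distrib]
  rw [this]; ring

lemma even_num {M : V → V → ℤ} (hsym : ∀ v w, M v w = M w v) (K₀ : V → ℤ) (hK : IsChar M K₀)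
    (x : V → ℤ) : 2 ∣ num M K₀ x := by
  have key : ((num M K₀ x : ℤ) : ZMod 2) = 0 := by
    have h1 : num M K₀ x = ∑ v, (K₀ v * x v + M v v * x v * x v)
        + ∑ v, ∑ w ∈ Finset.univ.erase v, x v * (M v w * x w) := by
      simp only [num, mv, Finset.mul_sum]
      rw [← Finset.sum_add_distrib, ← Finset.sum_add_distrib]
      refine Finset.sum_congr rfl fun v _ => ?_
      rw [← Finset.add_sum_erase _ _ (Finset.mem_univ v)]
      ring
    have h2 : (((∑ v, ∑ w ∈ Finset.univ.erase v, x v * (M v w * x w) : ℤ)) : ZMod 2) = 0 := by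
      push_cast
      apply sum_symm_zero (fun a => CharTwo.add_self_eq_zero a)
      intro v _ u _
      rw [hsym v u]; ring
    have h3 : ((∑ v, (K₀ v * x v + M v v * x v * x v) : ℤ) : ZMod 2) = 0 := by
      push_cast
      apply Finset.sum_eq_zero
      intro v _
      have hk : ((K₀ v : ℤ) : ZMod 2) = (M v v : ℤ) := by
        have := hK v
        exact (ZMod.intCast_eq_intCast_iff _ _ 2).2 this
      rw [hk]
      generalize ((M v v : ℤ) : ZMod 2) = a
      generalize ((x v : ℤ) : ZMod 2) = b
      revert a b
      decide
    rw [h1, Int.cast_add, h2, h3, add_zero]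
  exact (ZMod.intCast_zmod_eq_zero_iff_dvd _ 2).1 key

lemma sum_ind (I : Finset V) (f : V → ℤ) : ∑ v, ind I v * f v = ∑ v ∈ I, f v := by
  simp [ind, Finset.sum_ite_mem]

lemma latF_eq {M : V → V → ℤ} (hsym : ∀ v w, M v w = M w v) (K₀ : V → ℤ) (hK : IsChar M K₀)
    (x : V → ℤ) (I : Finset V) :
    latF M (KK M K₀ x) I = Q M K₀ (x + ind I) - Q M K₀ x := by
  have h1 := even_num hsym K₀ hK x
  have h2 := num_add hsym K₀ x (ind I)
  have h3 : (∑ v ∈ I, KK M K₀ x v) + ∑ v ∈ I, ∑ w ∈ I, M v w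
      = num M K₀ (ind I) + 2 * ∑ v, ind I v * mv M x v := by
    have e1 : num M K₀ (ind I) = ∑ v ∈ I, K₀ v + ∑ v ∈ I, ∑ w ∈ I, M v w := by
      have a1 : ∑ v, K₀ v * ind I v = ∑ v ∈ I, K₀ v := by
        rw [← sum_ind I]; exact Finset.sum_congr rfl fun v _ => mul_comm _ _
      have a2 : ∀ v, mv M (ind I) v = ∑ w ∈ I, M v w := by
        intro v
        rw [← sum_ind I]; exact Finset.sum_congr rfl fun v _ => mul_comm _ _
      rw [num, a1, sum_ind]
      simp only [a2]
    rw [e1, sum_ind]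
    have e2 : ∀ v, KK M K₀ x v = K₀ v + 2 * mv M x v := by
      intro v
      simp only [KK, mv]
      congr 2
      exact Finset.sum_congr rfl fun w _ => by rw [hsym w v, mul_comm]
    simp only [e2, Finset.sum_add_distrib, ← Finset.mul_sum]
    ring
  rw [latF, h3, Q, Q, h2]
  omega

lemma Q_add {M : V → V → ℤ} (hsym : ∀ v w, M v w = M w v) (K₀ : V → ℤ) (hK : IsChar M K₀)
    (x : V → ℤ) (v : V) :
    Q M K₀ (x + sg v) = Q M K₀ x + (K₀ v + M v v) / 2 + mv M x v := by
  have h1 := even_num hsym K₀ hK x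
  have h2 := num_add hsym K₀ x (sg v)
  have h3 : num M K₀ (sg v) = K₀ v + M v v := by
    simp [num, mv_sg, sg]
  have h4 : ∑ u, sg v u * mv M x u = mv M x v := by simp [sg]
  rw [h3, h4] at h2
  rw [Q, Q, h2]
  omega

lemma min_shift {ι : Type*} (P : Finset ι) (hP : P.Nonempty) (f g : ι → ℤ) (k : ℤ)
    (h : ∀ I, f I = g I - k) (hne : (P.image f).Nonempty) :
    (P.image f).min' hne = P.inf' hP g - k := by
  apply le_antisymm
  · obtain ⟨i, hi, he⟩ := Finset.exists_mem_eq_inf' hP g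
    rw [he, ← h]
    exact Finset.min'_le _ _ (Finset.mem_image_of_mem _ hi)
  · apply Finset.le_min'
    intro y hy
    obtain ⟨i, hi, rfl⟩ := Finset.mem_image.1 hy
    rw [h]
    have := Finset.inf'_le g hi
    omega

lemma latG_eq {M : V → V → ℤ} (hsym : ∀ v w, M v w = M w v) (K₀ : V → ℤ) (hK : IsChar M K₀)
    (x : V → ℤ) (E : Finset V) :
    latG M (KK M K₀ x) E = W (Q M K₀) x E - Q M K₀ x :=
  min_shift _ _ _ _ _ (latF_eq hsym K₀ hK x) _

lemma latB_eq {M : V → V → ℤ} (hsym : ∀ v w, M v w = M w v) (K₀ : V → ℤ) (hK : IsChar M K₀)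
    (x : V → ℤ) (E : Finset V) (v : V) :
    latB M (KK M K₀ x) E v = W (Q M K₀) (x + sg v) (E.erase v) - Q M K₀ x := by
  have key : ∀ I ∈ (E.erase v).powerset, latF M (KK M K₀ x) (insert v I)
      = Q M K₀ (x + sg v + ind I) - Q M K₀ x := by
    intro I hI
    have hv : v ∉ I := fun h => Finset.notMem_erase v E (Finset.mem_powerset.1 hI h)
    rw [latF_eq hsym K₀ hK, ind_insert hv, add_assoc]
  have e : (E.erase v).powerset.image (fun I => latF M (KK M K₀ x) (insert v I))
      = (E.erase v).powerset.image (fun I => Q M K₀ (x + sg v + ind I) - Q M K₀ x) :=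
    Finset.image_congr key
  unfold latB
  simp only [e]
  exact min_shift _ _ _ _ _ (fun I => rfl) _

/-- the identification of cells -/
noncomputable def cellEquiv {M : V → V → ℤ} (h : NegDef M) (hsym : ∀ v w, M v w = M w v)
    (K₀ : V → ℤ) : Cell V ≃ {K : V → ℤ // CharCl M K₀ K} × Finset V :=
  Equiv.prodCongr (Equiv.ofBijective (fun x => ⟨KK M K₀ x, x, fun _ => rfl⟩) (by
    constructor
    · intro x y hxy
      apply mv_inj h
      intro v
      have h1 := congrFun (congrArg Subtype.val hxy) v
      simp only [KK] at h1
      have e : ∀ z : V → ℤ, mv M z v = ∑ u, z u * M u v := fun z =>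
        Finset.sum_congr rfl fun u _ => by rw [hsym u v, mul_comm]
      rw [e, e]
      omega
    · rintro ⟨K, n, hn⟩
      exact ⟨n, Subtype.ext (funext fun w => (hn w).symm)⟩)) (Equiv.refl _)

lemma cellEquiv_val {M : V → V → ℤ} (h : NegDef M) (hsym : ∀ v w, M v w = M w v)
    (K₀ : V → ℤ) (c : Cell V) :
    cellEquiv h hsym K₀ c = (⟨KK M K₀ c.1, c.1, fun _ => rfl⟩, c.2) := rfl

lemma KK_add (M : V → V → ℤ) (K₀ x : V → ℤ) (v : V) :
    KK M K₀ (x + sg v) = fun w => KK M K₀ x w + 2 * M v w := by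
  ext w
  have : ∑ u, sg v u * M u w = M v w := by simp [sg]
  simp only [KK, Pi.add_apply, add_mul, Finset.sum_add_distrib, this]
  ring

noncomputable def tr {M : V → V → ℤ} (h : NegDef M) (hsym : ∀ v w, M v w = M w v)
    (K₀ : V → ℤ) : Ch V ≃ₗ[ZMod 2] Chat M K₀ :=
  Finsupp.domLCongr (cellEquiv h hsym K₀)

lemma tr_D {M : V → V → ℤ} (h : NegDef M) (hsym : ∀ v w, M v w = M w v)
    (K₀ : V → ℤ) (hK : IsChar M K₀) (z : Ch V) :
    tr h hsym K₀ (D (Q M K₀) z) = dhat M K₀ (tr h hsym K₀ z) := by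
  have : (tr h hsym K₀).toLinearMap.comp (D (Q M K₀))
      = (dhat M K₀).comp (tr h hsym K₀).toLinearMap := by
    apply Finsupp.lhom_ext'
    rintro ⟨x, E⟩
    ext1
    simp only [LinearMap.comp_apply, Finsupp.lsingle_apply, LinearEquiv.coe_coe]
    have e1 : tr h hsym K₀ (Finsupp.single (x, E) 1)
        = Finsupp.single (cellEquiv h hsym K₀ (x, E)) 1 := by simp [tr]
    have e2 : dhat M K₀ (Finsupp.single (cellEquiv h hsym K₀ (x, E)) 1) =
        ∑ v ∈ E, ((if lata M (KK M K₀ x) E v = 0 then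
            Finsupp.single (cellEquiv h hsym K₀ (x, E.erase v)) (1 : ZMod 2) else 0)
          + (if latb M (KK M K₀ x) E v = 0 then
            Finsupp.single (cellEquiv h hsym K₀ (x + sg v, E.erase v)) (1 : ZMod 2) else 0)) := by
      simp only [dhat, Finsupp.lift_apply]
      rw [Finsupp.sum_single_index (by simp), one_smul]
      simp only [cellEquiv_val, KK_add]
      rfl
    rw [e1, e2, D_single, map_sum]
    apply Finset.sum_congr rfl
    intro v _
    rw [Fintype.sum_bool, map_add, add_comm]
    congr 1
    · have hiff : lata M (KK M K₀ x) E v = 0 ↔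
          Wc (Q M K₀) (fc v false (x, E)) = Wc (Q M K₀) (x, E) := by
        rw [lata, latG_eq hsym K₀ hK, latG_eq hsym K₀ hK]
        simp [Wc, fc, sub_eq_zero]
      rw [term, if_congr hiff rfl rfl]
      split_ifs
      · simp [tr, fc]
      · simp
    · have hiff : latb M (KK M K₀ x) E v = 0 ↔
          Wc (Q M K₀) (fc v true (x, E)) = Wc (Q M K₀) (x, E) := by
        rw [latb, latG_eq hsym K₀ hK, latB_eq hsym K₀ hK]
        simp [Wc, fc, sub_eq_zero]
      rw [term, if_congr hiff rfl rfl]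
      split_ifs
      · simp [tr, fc]
      · simp
  exact LinearMap.congr_fun this z

end transport

end LatHat

/-- `∂̂ ∘ ∂̂ = 0`, and the homology `ĤF(G,𝔰)` of the hat lattice complex is a
finite-dimensional `𝔽`-vector space. -/
theorem stmt17 [Fintype V] [DecidableEq V] (M : V → V → ℤ)
    (hsym : ∀ v w, M v w = M w v)
    (hoff : ∀ v w, v ≠ w → M v w = 0 ∨ M v w = 1)
    (hneg : NegDef M)
    (K₀ : V → ℤ) (hK₀ : IsChar M K₀) :
    (dhat M K₀).comp (dhat M K₀) = 0 ∧
    FiniteDimensional (ZMod 2)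
      (↥(LinearMap.ker (dhat M K₀)) ⧸
        (Submodule.comap (LinearMap.ker (dhat M K₀)).subtype (LinearMap.range (dhat M K₀)) :
          Submodule (ZMod 2) ↥(LinearMap.ker (dhat M K₀)))) := by
  have hdd : (dhat M K₀).comp (dhat M K₀) = 0 := by
    refine LinearMap.ext fun z => ?_
    obtain ⟨z, rfl⟩ := (LatHat.tr hneg hsym K₀).surjective z
    rw [LinearMap.comp_apply, ← LatHat.tr_D hneg hsym K₀ hK₀, ← LatHat.tr_D hneg hsym K₀ hK₀]
    have := LinearMap.congr_fun (LatHat.D_D (LatHat.Q M K₀)) z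
    rw [LinearMap.comp_apply] at this
    rw [this]
    simp
  refine ⟨hdd, ?_⟩
  obtain ⟨S, hS, hred⟩ := LatHat.finite_red hneg hoff (LatHat.Q M K₀) _
    (LatHat.Q_add hsym K₀ hK₀)
  let P : Submodule (ZMod 2) (Chat M K₀) :=
    (Finsupp.supported (ZMod 2) (ZMod 2) S).map (LatHat.tr hneg hsym K₀).toLinearMap
  have : Finite S := hS
  have : FiniteDimensional (ZMod 2) (Finsupp.supported (ZMod 2) (ZMod 2) S) :=
    Module.Finite.equiv (Finsupp.supportedEquivFinsupp (M := ZMod 2) (R := ZMod 2) S).symm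
  have : FiniteDimensional (ZMod 2) P := inferInstance
  let P' : Submodule (ZMod 2) (Chat M K₀) := P ⊓ LinearMap.ker (dhat M K₀)
  have : FiniteDimensional (ZMod 2) P' := Submodule.finiteDimensional_inf_left _ _
  let j : P' →ₗ[ZMod 2] LinearMap.ker (dhat M K₀) := Submodule.inclusion inf_le_right
  apply Module.Finite.of_surjective ((Submodule.mkQ _).comp j)
  intro y
  obtain ⟨⟨z, hz⟩, rfl⟩ := Submodule.mkQ_surjective _ y
  obtain ⟨z, rfl⟩ := (LatHat.tr hneg hsym K₀).surjective z
  rw [LinearMap.mem_ker, ← LatHat.tr_D hneg hsym K₀ hK₀] at hz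
  have hz' : LatHat.D (LatHat.Q M K₀) z = 0 := by simpa using hz
  obtain ⟨u, hu⟩ := hred z (by simp) hz'
  have hk : LatHat.tr hneg hsym K₀ (z + LatHat.D (LatHat.Q M K₀) u)
      ∈ LinearMap.ker (dhat M K₀) := by
    rw [LinearMap.mem_ker, ← LatHat.tr_D hneg hsym K₀ hK₀, map_add, hz', zero_add]
    have := LinearMap.congr_fun (LatHat.D_D (LatHat.Q M K₀)) u
    rw [LinearMap.comp_apply] at this
    rw [this]
    simp
  refine ⟨⟨_, Submodule.mem_map_of_mem hu, hk⟩, ?_⟩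
  rw [LinearMap.comp_apply, Submodule.mkQ_apply, Submodule.mkQ_apply, Submodule.Quotient.eq]
  rw [Submodule.mem_comap]
  refine ⟨LatHat.tr hneg hsym K₀ u, ?_⟩
  rw [← LatHat.tr_D hneg hsym K₀ hK₀]
  simp [j, Submodule.inclusion]
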